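/- Let −3 < γ ≤ 1, β ∈ ℝ and 1 ≤ q < min{3, 3/|γ|} (with the convention min{3, 3/|γ|} = 3 when γ = 0). Let k_α : ℝ³ × ℝ³ → ℝ be a measurable kernel for which there exist constants C₀ > 0 and α₁, α₂, α₃ > 0 such that for all v ≠ v_*, both |k_α(v, v_*)| ≤ C₀ w_γ(|v − v_*|) (1 + |v| + |v_*|)^{γ−1} e^{−α₁ |v − v_*|²} e^{−α₃ ((v − v_*)·v/|v − v_*| − α₂ |v − v_*|)²} and |k_α(v, v_*)| ≤ C₀ w_γ(|v − v_*|) (1 + |v| + |v_*|)^{γ−1} e^{−α₁ |v − v_*|²} e^{−α₃ ((v − v_*)·v_*/|v − v_*| + α₂ |v − v_*|)²} hold. Then there exists a constant C > 0 such that ∫_{ℝ³} |k_α(v, v_*)|^q (1 + |v_*|)^β dv_* ≤ C (1 + |v|)^{β + q(γ−1) − 1} for all v ∈ ℝ³, and ∫_{ℝ³} |k_α(v, v_*)|^q (1 + |v|)^β dv ≤ C (1 + |v_*|)^{β + q(γ−1) − 1} for all v_* ∈ ℝ³. -/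

import Mathlib

open MeasureTheory Real Set
open scoped ENNReal RealInnerProductSpace

noncomputable section

/-- `ℝ³` as a Euclidean space. -/
abbrev E3 : Type := EuclideanSpace ℝ (Fin 3)

/-- The singular weight `w_γ`. -/
def wGamma (γ r : ℝ) : ℝ :=
  if -1 < γ then 1 / r
  else if γ = -1 then (|Real.log r| + 1) / r
  else 1 / r ^ |γ|

/-- `min {3, 3/|γ|}`, with the convention that it equals `3` when `γ = 0`. -/
def minExp (γ : ℝ) : ℝ := if γ = 0 then 3 else min 3 (3 / |γ|)

/-- Every unit vector of `ℝ³` is the first vector of an orthonormal basis. -/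
theorem exists_orthonormalBasis_zero_eq {e : E3} (he : ‖e‖ = 1) :
    ∃ b : OrthonormalBasis (Fin 3) ℝ E3, b 0 = e := by
  have hv : Orthonormal ℝ (({0} : Set (Fin 3)).domRestrict (fun _ => e)) := by
    refine ⟨fun i => by simpa using he, fun i j hij => ?_⟩
    exact absurd (Subsingleton.elim i j) hij
  obtain ⟨b, hb⟩ := hv.exists_orthonormalBasis_extension_of_card_eq (by simp)
  exact ⟨b, hb 0 rfl⟩

/-- The linear coordinates of `ℝ³` along an orthonormal basis, as a point of `ℝ × ℝ × ℝ`. -/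
theorem measurePreserving_coords (b : OrthonormalBasis (Fin 3) ℝ E3) :
    MeasurePreserving (fun u : E3 => ((⟪b 0, u⟫, ⟪b 1, u⟫, ⟪b 2, u⟫) : ℝ × ℝ × ℝ)) := by
  have h1 := b.measurePreserving_repr
  have h2 := EuclideanSpace.volume_preserving_symm_measurableEquiv_toLp (Fin 3)
  have h3 := volume_preserving_piFinSuccAbove (fun _ : Fin 3 => ℝ) 0
  have h4 := (MeasurePreserving.id (volume : Measure ℝ)).prod
    (volume_preserving_finTwoArrow ℝ)
  have h := h4.comp (h3.comp (h2.comp h1))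
  have hcoords : (fun u : E3 => ((⟪b 0, u⟫, ⟪b 1, u⟫, ⟪b 2, u⟫) : ℝ × ℝ × ℝ)) =
      Prod.map id MeasurableEquiv.finTwoArrow ∘ MeasurableEquiv.piFinSuccAbove (fun _ => ℝ) 0 ∘
        (MeasurableEquiv.toLp 2 (Fin 3 → ℝ)).symm ∘ b.repr := by
    funext u
    simp only [← b.repr_apply_apply]
    rfl
  rw [hcoords]
  exact h

/-- Integration over the plane of a radial function. -/
theorem lintegral_radial_plane {f : ℝ → ℝ≥0∞} (hf : Measurable f) :
    ∫⁻ p : ℝ × ℝ, f (p.1 ^ 2 + p.2 ^ 2) =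
      ENNReal.ofReal (2 * π) * ∫⁻ ρ in Ioi (0 : ℝ), ENNReal.ofReal ρ * f (ρ ^ 2) := by
  rw [← lintegral_comp_polarCoord_symm, polarCoord_target, Measure.volume_eq_prod,
    setLIntegral_prod]
  · have h : ∀ ρ θ : ℝ, ENNReal.ofReal ρ • f ((polarCoord.symm (ρ, θ)).1 ^ 2 +
        (polarCoord.symm (ρ, θ)).2 ^ 2) = ENNReal.ofReal ρ * f (ρ ^ 2) := by
      intro ρ θ
      have : (ρ * cos θ) ^ 2 + (ρ * sin θ) ^ 2 = ρ ^ 2 := by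
        linear_combination ρ ^ 2 * Real.sin_sq_add_cos_sq θ
      simp [polarCoord_symm_apply, this]
    simp only [h]
    simp only [lintegral_const, Measure.restrict_apply_univ, Real.volume_Ioo]
    rw [lintegral_mul_const _ (by fun_prop), mul_comm]
    congr 2
    ring
  · have : Measurable fun p : ℝ × ℝ => polarCoord.symm p := by
      simp only [polarCoord_symm_apply]
      fun_prop
    simp only [smul_eq_mul]
    fun_prop

/-- The change of variables `r = √(z² + ρ²)` at fixed `z`. -/
theorem lintegral_sqrt_sq_add_sq (z : ℝ) (f : ℝ → ℝ≥0∞) :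
    ∫⁻ ρ in Ioi (0 : ℝ), ENNReal.ofReal ρ * f √(z ^ 2 + ρ ^ 2) =
      ∫⁻ r in Ioi |z|, ENNReal.ofReal r * f r := by
  have himg : (fun ρ : ℝ => √(z ^ 2 + ρ ^ 2)) '' Ioi 0 = Ioi |z| := by
    ext r
    simp only [mem_image, mem_Ioi]
    constructor
    · rintro ⟨ρ, hρ, rfl⟩
      exact Real.lt_sqrt_of_sq_lt (by rw [sq_abs]; nlinarith)
    · intro hr
      have hr0 : 0 < r := (abs_nonneg z).trans_lt hr
      have hlt : z ^ 2 < r ^ 2 := sq_lt_sq.2 (by rwa [abs_of_pos hr0])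
      refine ⟨√(r ^ 2 - z ^ 2), Real.sqrt_pos.2 (by linarith), ?_⟩
      rw [Real.sq_sqrt (by linarith), add_sub_cancel, Real.sqrt_sq hr0.le]
  have hpos : ∀ ρ ∈ Ioi (0 : ℝ), 0 < z ^ 2 + ρ ^ 2 := fun ρ hρ => by
    have : 0 < ρ := hρ
    positivity
  rw [← himg, lintegral_image_eq_lintegral_abs_deriv_mul (f' := fun ρ => ρ / √(z ^ 2 + ρ ^ 2))
    measurableSet_Ioi]
  · refine setLIntegral_congr_fun measurableSet_Ioi fun ρ hρ => ?_
    have h := Real.sqrt_pos.2 (hpos ρ hρ)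
    have hρ' : 0 < ρ := hρ
    rw [← mul_assoc, ← ENNReal.ofReal_mul (abs_nonneg _), abs_of_pos (by positivity),
      div_mul_cancel₀ _ h.ne']
  · intro ρ hρ
    have h : HasDerivAt (fun ρ : ℝ => z ^ 2 + ρ ^ 2) (2 * ρ) ρ := by
      simpa using (hasDerivAt_pow 2 ρ).const_add (z ^ 2)
    have h' := (h.sqrt (hpos ρ hρ).ne').hasDerivWithinAt (s := Ioi 0)
    rwa [mul_div_mul_left _ _ (two_ne_zero' ℝ)] at h'
  · intro x hx y hy hxy
    have hx' : 0 < x := hx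
    have hy' : 0 < y := hy
    have := (Real.sqrt_inj (hpos x hx).le (hpos y hy).le).1 hxy
    nlinarith

/-- Spherical coordinates in `ℝ³` for functions of `‖u‖` and `⟪e, u⟫`, where `‖e‖ = 1`. -/
theorem lintegral_norm_inner {e : E3} (he : ‖e‖ = 1) {H : ℝ → ℝ → ℝ≥0∞}
    (hH : Measurable (Function.uncurry H)) :
    ∫⁻ u : E3, H ‖u‖ ⟪e, u⟫ =
      ENNReal.ofReal (2 * π) *
        ∫⁻ r in Ioi (0 : ℝ), ∫⁻ z in Ioo (-r) r, ENNReal.ofReal r * H r z := by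
  obtain ⟨b, rfl⟩ := exists_orthonormalBasis_zero_eq he
  have hH' : ∀ {α : Type} [MeasurableSpace α] {f g : α → ℝ}, Measurable f → Measurable g →
      Measurable fun x => H (f x) (g x) := fun hf hg => hH.comp (hf.prodMk hg)
  have hnorm : ∀ u : E3, ‖u‖ = √(⟪b 0, u⟫ ^ 2 + (⟪b 1, u⟫ ^ 2 + ⟪b 2, u⟫ ^ 2)) := by
    intro u
    rw [← Real.sqrt_sq (norm_nonneg u), ← b.sum_sq_norm_inner_right u, Fin.sum_univ_three]
    simp [add_assoc]
  simp only [hnorm]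
  rw [(measurePreserving_coords b).lintegral_comp
    (f := fun p : ℝ × ℝ × ℝ => H √(p.1 ^ 2 + (p.2.1 ^ 2 + p.2.2 ^ 2)) p.1)
    (hH' (by fun_prop) (by fun_prop)), Measure.volume_eq_prod,
    lintegral_prod _ (hH' (by fun_prop) (by fun_prop)).aemeasurable]
  have hz : ∀ z : ℝ, ∫⁻ p : ℝ × ℝ, H √(z ^ 2 + (p.1 ^ 2 + p.2 ^ 2)) z =
      ENNReal.ofReal (2 * π) * ∫⁻ r, (Ioi |z|).indicator (fun r => ENNReal.ofReal r * H r z) r := by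
    intro z
    rw [lintegral_radial_plane (f := fun s => H √(z ^ 2 + s) z) (hH' (by fun_prop) (by fun_prop)),
      lintegral_sqrt_sq_add_sq z fun r => H r z, lintegral_indicator measurableSet_Ioi]
  have hmeas : Measurable (Function.uncurry fun z : ℝ =>
      (Ioi |z|).indicator fun r => ENNReal.ofReal r * H r z) := by
    have hs : MeasurableSet {p : ℝ × ℝ | |p.1| < p.2} :=
      measurableSet_lt (by fun_prop) (by fun_prop)
    have hm : Measurable fun p : ℝ × ℝ => ENNReal.ofReal p.2 * H p.2 p.1 :=
      (by fun_prop : Measurable fun p : ℝ × ℝ => ENNReal.ofReal p.2).mul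
        (hH' (by fun_prop) (by fun_prop))
    exact hm.indicator hs
  simp only [hz]
  rw [lintegral_const_mul' _ _ ENNReal.ofReal_ne_top,
    lintegral_lintegral_swap hmeas.aemeasurable, ← lintegral_indicator measurableSet_Ioi]
  congr 1
  refine lintegral_congr fun r => ?_
  have hset : ∀ z : ℝ, (Ioi |z|).indicator (fun r => ENNReal.ofReal r * H r z) r =
      (Ioo (-r) r).indicator (fun z => ENNReal.ofReal r * H r z) z := by
    intro z
    simp only [indicator, mem_Ioi, mem_Ioo, abs_lt]
  simp only [hset]
  rw [lintegral_indicator measurableSet_Ioo]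
  by_cases hr : r ∈ Ioi (0 : ℝ)
  · rw [indicator_of_mem hr]
  · have : Ioo (-r) r = ∅ := Ioo_eq_empty (by simp only [mem_Ioi] at hr; linarith)
    simp [indicator_of_notMem hr, this]

theorem lintegral_gaussian_affine {c A r : ℝ} (hc : 0 < c) (hA : 0 < A) (hr : 0 < r) (t : ℝ) :
    ∫⁻ z : ℝ, ENNReal.ofReal (rexp (-c * (z * A / r + t) ^ 2)) =
      ENNReal.ofReal (√(π / c) * (r / A)) := by
  have hb : 0 < c * (A / r) ^ 2 := by positivity
  have h : ∀ z : ℝ, ENNReal.ofReal (rexp (-c * (z * A / r + t) ^ 2)) =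
      (fun y => ENNReal.ofReal (rexp (-(c * (A / r) ^ 2) * y ^ 2))) (z + t * r / A) := by
    intro z
    beta_reduce
    congr 2
    field_simp
  simp only [h]
  rw [lintegral_add_right_eq_self (fun y => ENNReal.ofReal (rexp (-(c * (A / r) ^ 2) * y ^ 2))),
    ← ofReal_integral_eq_lintegral_ofReal (integrable_exp_neg_mul_sq hb)
    (ae_of_all _ fun _ => (exp_pos _).le), integral_gaussian]
  congr 1
  rw [← div_div, Real.sqrt_div (by positivity), Real.sqrt_sq (by positivity)]
  field_simp

/-- A Gaussian in an affine function of slope `A / r` over an interval of length `2r`. -/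
theorem setLIntegral_gaussian_affine_le {c A r : ℝ} (hc : 0 < c) (hA : 0 ≤ A) (hr : 0 < r)
    (t : ℝ) :
    ∫⁻ z in Ioo (-r) r, ENNReal.ofReal (rexp (-c * (z * A / r + t) ^ 2)) ≤
      ENNReal.ofReal ((4 + 2 * √(π / c)) / (1 + A) * r) := by
  have hs := Real.sqrt_nonneg (π / c)
  rcases le_total A 1 with h | h
  · calc _ ≤ ∫⁻ z in Ioo (-r) r, 1 := by
          refine lintegral_mono fun z => ?_
          rw [ENNReal.ofReal_le_one, exp_le_one_iff]
          nlinarith [sq_nonneg (z * A / r + t)]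
      _ = ENNReal.ofReal (2 * r) := by simp [two_mul]
      _ ≤ _ := by
          gcongr
          rw [le_div_iff₀ (by positivity)]
          linarith
  · have hA' : 0 < A := by linarith
    refine (setLIntegral_le_lintegral _ _).trans ?_
    rw [lintegral_gaussian_affine hc hA' hr]
    refine ENNReal.ofReal_le_ofReal ?_
    rw [mul_div_assoc', div_mul_eq_mul_div, div_le_div_iff₀ hA' (by positivity)]
    nlinarith [mul_nonneg hs (mul_nonneg hr.le (sub_nonneg.2 h)), mul_nonneg hr.le hA'.le]

/-- Averaging a Gaussian in the radial component of `a` over directions gains `1 / (1 + ‖a‖)`. -/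
theorem lintegral_radial_mul_gaussian_le {c : ℝ} (hc : 0 < c) (τ : ℝ) {G : ℝ → ℝ≥0∞}
    (hG : Measurable G) (a : E3) :
    ∫⁻ u : E3, G ‖u‖ * ENNReal.ofReal (rexp (-c * (⟪u, a⟫ / ‖u‖ + τ * ‖u‖) ^ 2)) ≤
      ENNReal.ofReal (2 * π * ((4 + 2 * √(π / c)) / (1 + ‖a‖))) *
        ∫⁻ r in Ioi (0 : ℝ), G r * ENNReal.ofReal (r ^ 2) := by
  obtain ⟨e, he, hea⟩ : ∃ e : E3, ‖e‖ = 1 ∧ a = ‖a‖ • e := by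
    rcases eq_or_ne a 0 with rfl | ha
    · obtain ⟨e, he⟩ := exists_norm_eq E3 zero_le_one
      exact ⟨e, he, by simp⟩
    · exact ⟨‖a‖⁻¹ • a, by simp [norm_smul, ha], by simp [smul_smul, ha]⟩
  have hinner : ∀ u : E3, ⟪u, a⟫ = ⟪e, u⟫ * ‖a‖ := fun u => by
    conv_lhs => rw [hea, inner_smul_right, real_inner_comm, mul_comm]
  simp only [hinner]
  rw [lintegral_norm_inner he
    (H := fun r z => G r * ENNReal.ofReal (rexp (-c * (z * ‖a‖ / r + τ * r) ^ 2)))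
    ((hG.comp measurable_fst).mul (by fun_prop)),
    ENNReal.ofReal_mul (p := 2 * π) (by positivity), mul_assoc,
    ← lintegral_const_mul' (ENNReal.ofReal (_ / _)) _ ENNReal.ofReal_ne_top]
  gcongr ENNReal.ofReal (2 * π) * ?_
  refine setLIntegral_mono' measurableSet_Ioi fun r (hr : 0 < r) => ?_
  simp only [← mul_assoc]
  rw [lintegral_const_mul _ (by fun_prop)]
  calc _ ≤ ENNReal.ofReal r * G r * ENNReal.ofReal ((4 + 2 * √(π / c)) / (1 + ‖a‖) * r) := by
        gcongr
        exact setLIntegral_gaussian_affine_le hc (norm_nonneg a) hr _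
    _ = _ := by
        rw [ENNReal.ofReal_mul (by positivity), pow_two, ENNReal.ofReal_mul hr.le]
        ring

theorem abs_log_add_one_le {δ r : ℝ} (hδ : 0 < δ) (hδ1 : δ ≤ 1) (hr : 0 < r) :
    |Real.log r| + 1 ≤ (1 / δ + 1) * r ^ (-δ) * (1 + r) ^ 2 := by
  have hneg : -Real.log r ≤ r ^ (-δ) / δ := by
    have h := Real.log_le_rpow_div (x := r⁻¹) (by positivity) hδ
    rwa [Real.log_inv, Real.inv_rpow hr.le, ← Real.rpow_neg hr.le] at h
  have hpos : 0 < r ^ (-δ) := by positivity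
  have hone : 1 ≤ r ^ (-δ) * (1 + r) := by
    rw [Real.rpow_neg hr.le, ← div_eq_inv_mul, one_le_div (by positivity)]
    calc r ^ δ ≤ (1 + r) ^ δ := by gcongr; linarith
      _ ≤ (1 + r) ^ (1 : ℝ) := Real.rpow_le_rpow_of_exponent_le (by linarith) hδ1
      _ = 1 + r := Real.rpow_one _
  have hlog : Real.log r ≤ r := (Real.log_le_sub_one_of_pos hr).trans (by linarith)
  have habs : |Real.log r| + 1 ≤ r ^ (-δ) / δ + (1 + r) := by
    have : 0 < r ^ (-δ) / δ := by positivity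
    rcases abs_cases (Real.log r) with h | h <;> linarith
  have h1 : r ^ (-δ) / δ ≤ 1 / δ * r ^ (-δ) * (1 + r) ^ 2 := by
    rw [div_eq_mul_inv, mul_comm, ← one_div]
    exact le_mul_of_one_le_right (by positivity) (by nlinarith)
  nlinarith

/-- A power-type majorant of the singular weight whose `q`-th power is integrable near `0`
against `r ^ 2`. -/
theorem exists_wGamma_le {γ q : ℝ} (hq1 : 1 ≤ q) (hq2 : q < minExp γ) :
    ∃ m K : ℝ, 0 < K ∧ m * q < 3 ∧
      ∀ r : ℝ, 0 < r → wGamma γ r ≤ K * r ^ (-m) * (1 + r) ^ 2 := by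
  have hq3 : q < 3 := by
    unfold minExp at hq2
    split_ifs at hq2
    · exact hq2
    · exact hq2.trans_le (min_le_left _ _)
  have hone : ∀ r : ℝ, 0 < r → (1 : ℝ) ≤ (1 + r) ^ 2 := fun r hr => by nlinarith
  rcases lt_trichotomy γ (-1) with h | h | h
  · refine ⟨|γ|, 1, one_pos, ?_, fun r hr => ?_⟩
    · have h0 : γ ≠ 0 := by linarith
      rw [minExp, if_neg h0] at hq2
      have := hq2.trans_le (min_le_right _ _)
      rw [lt_div_iff₀ (abs_pos.2 h0)] at this
      linarith
    · rw [wGamma, if_neg h.not_gt, if_neg h.ne, Real.rpow_neg hr.le, one_mul, one_div]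
      exact le_mul_of_one_le_right (by positivity) (hone r hr)
  · have h3q : 1 < 3 / q := by rw [lt_div_iff₀ (by linarith)]; linarith
    have h3q' : 3 / q ≤ 3 := div_le_self (by norm_num) hq1
    have hδ : 0 < (3 / q - 1) / 2 := by linarith
    refine ⟨1 + (3 / q - 1) / 2, 1 / ((3 / q - 1) / 2) + 1, by positivity, ?_, fun r hr => ?_⟩
    · field_simp
      linarith
    · rw [wGamma, if_neg (by simp [h]), if_pos h, neg_add, Real.rpow_add hr, Real.rpow_neg_one,
        div_eq_inv_mul]
      exact (mul_le_mul_of_nonneg_left (abs_log_add_one_le hδ (by linarith) hr)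
        (by positivity)).trans_eq (by ring)
  · refine ⟨1, 1, one_pos, by linarith, fun r hr => ?_⟩
    rw [wGamma, if_pos h, Real.rpow_neg_one, one_mul, one_div]
    exact le_mul_of_one_le_right (by positivity) (hone r hr)

/-- Peetre's inequality. -/
theorem one_add_rpow_le {A X r : ℝ} (hA : 0 ≤ A) (hX : 0 ≤ X) (h : |A - X| ≤ r) (β : ℝ) :
    (1 + X) ^ β ≤ (1 + A) ^ β * (1 + r) ^ |β| := by
  have hr : 0 ≤ r := (abs_nonneg _).trans h
  obtain ⟨h1, h2⟩ := abs_le.1 h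
  rcases le_total 0 β with hβ | hβ
  · rw [abs_of_nonneg hβ, ← Real.mul_rpow (by positivity) (by positivity)]
    gcongr
    nlinarith [mul_nonneg hA hr]
  · rw [abs_of_nonpos hβ, Real.rpow_neg (by positivity), ← div_eq_mul_inv,
      le_div_iff₀ (by positivity), ← Real.mul_rpow (by positivity) (by positivity)]
    exact Real.rpow_le_rpow_of_nonpos (by positivity) (by nlinarith [mul_nonneg hX hr]) hβ

theorem one_add_rpow_le_exp {N b r : ℝ} (hN : 0 ≤ N) (hb : 0 < b) (hr : 0 ≤ r) :
    (1 + r) ^ N ≤ rexp (N ^ 2 / (2 * b)) * rexp (b / 2 * r ^ 2) := by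
  rw [← Real.exp_add]
  calc (1 + r) ^ N ≤ rexp r ^ N := by
        gcongr
        linarith [Real.add_one_le_exp r]
    _ = rexp (r * N) := (Real.exp_mul _ _).symm
    _ ≤ _ := by
        gcongr
        have : 0 ≤ (b * r - N) ^ 2 / (2 * b) := by positivity
        have h : (b * r - N) ^ 2 / (2 * b) = N ^ 2 / (2 * b) + b / 2 * r ^ 2 - r * N := by
          field_simp
          ring
        linarith

theorem rpow_kernel_bound {γ β q C₀ α₁ α₃ K m A X r y W κ : ℝ} (hγu : γ ≤ 1) (hq1 : 1 ≤ q)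
    (hC₀ : 0 < C₀) (hα₁ : 0 < α₁) (hK : 0 < K) (hA : 0 ≤ A) (hX : 0 ≤ X) (hr : 0 < r)
    (hAX : |A - X| ≤ r) (hW : W ≤ K * r ^ (-m) * (1 + r) ^ 2) (hκ0 : 0 ≤ κ)
    (hκ : κ ≤ C₀ * W * (1 + A + X) ^ (γ - 1) * rexp (-α₁ * r ^ 2) * rexp (-α₃ * y ^ 2)) :
    κ ^ q * (1 + X) ^ β ≤
      ((C₀ * K) ^ q * rexp ((2 * q + |β|) ^ 2 / (2 * (q * α₁))) * (1 + A) ^ (β + q * (γ - 1))) *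
        (r ^ (-(m * q)) * rexp (-(q * α₁ / 2) * r ^ 2) * rexp (-(q * α₃) * y ^ 2)) := by
  have hq : 0 < q := by linarith
  have hκ' : κ ≤ (C₀ * K) * r ^ (-m) * (1 + r) ^ (2 : ℝ) * (1 + A) ^ (γ - 1) *
      rexp (-α₁ * r ^ 2) * rexp (-α₃ * y ^ 2) := by
    refine hκ.trans ?_
    gcongr ?_ * ?_ * _ * _
    · rw [Real.rpow_two]
      calc C₀ * W ≤ C₀ * (K * r ^ (-m) * (1 + r) ^ 2) := by gcongr
        _ = _ := by ring
    · exact Real.rpow_le_rpow_of_nonpos (by positivity) (by linarith) (by linarith)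
  have hpow : κ ^ q ≤ (C₀ * K) ^ q * r ^ (-(m * q)) * (1 + r) ^ (2 * q) *
      (1 + A) ^ (q * (γ - 1)) * rexp (-(q * α₁) * r ^ 2) * rexp (-(q * α₃) * y ^ 2) := by
    refine (Real.rpow_le_rpow hκ0 hκ' hq.le).trans_eq ?_
    rw [Real.mul_rpow (by positivity) (by positivity), Real.mul_rpow (by positivity) (by positivity),
      Real.mul_rpow (by positivity) (by positivity), Real.mul_rpow (by positivity) (by positivity),
      Real.mul_rpow (by positivity) (by positivity), ← Real.rpow_mul hr.le,
      ← Real.rpow_mul (by positivity), ← Real.rpow_mul (by positivity), ← Real.exp_mul,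
      ← Real.exp_mul]
    ring_nf
  have hexp : rexp (-(q * α₁ / 2) * r ^ 2) =
      rexp (q * α₁ / 2 * r ^ 2) * rexp (-(q * α₁) * r ^ 2) := by
    rw [← Real.exp_add]
    ring_nf
  calc κ ^ q * (1 + X) ^ β
      ≤ ((C₀ * K) ^ q * r ^ (-(m * q)) * (1 + r) ^ (2 * q) * (1 + A) ^ (q * (γ - 1)) *
          rexp (-(q * α₁) * r ^ 2) * rexp (-(q * α₃) * y ^ 2)) *
          ((1 + A) ^ β * (1 + r) ^ |β|) := by
        gcongr
        exact one_add_rpow_le hA hX hAX β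
    _ = ((C₀ * K) ^ q * r ^ (-(m * q)) * (1 + A) ^ (β + q * (γ - 1)) *
          rexp (-(q * α₁) * r ^ 2) * rexp (-(q * α₃) * y ^ 2)) * (1 + r) ^ (2 * q + |β|) := by
        rw [Real.rpow_add (by positivity : 0 < 1 + A), Real.rpow_add (by positivity : 0 < 1 + r)]
        ring
    _ ≤ ((C₀ * K) ^ q * r ^ (-(m * q)) * (1 + A) ^ (β + q * (γ - 1)) *
          rexp (-(q * α₁) * r ^ 2) * rexp (-(q * α₃) * y ^ 2)) *
          (rexp ((2 * q + |β|) ^ 2 / (2 * (q * α₁))) * rexp (q * α₁ / 2 * r ^ 2)) := by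
        gcongr
        exact one_add_rpow_le_exp (by positivity) (by positivity) hr.le
    _ = _ := by
        rw [hexp]
        ring

theorem lintegral_rpow_mul_exp_mul_sq_lt_top {s b : ℝ} (hs : s < 3) (hb : 0 < b) :
    ∫⁻ r in Ioi (0 : ℝ), ENNReal.ofReal (r ^ (-s) * rexp (-b * r ^ 2)) * ENNReal.ofReal (r ^ 2)
      < ⊤ := by
  have h := (integrableOn_rpow_mul_exp_neg_mul_sq hb (s := -s + 2) (by linarith)).lintegral_lt_top
  refine (setLIntegral_congr_fun measurableSet_Ioi fun r (hr : 0 < r) => ?_).trans_lt h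
  rw [← ENNReal.ofReal_mul (by positivity), Real.rpow_add hr, Real.rpow_two]
  ring_nf

/-- The decay estimate in the relative variable `u`, uniformly in the centre `a` and in `τ`. -/
theorem exists_lintegral_kernel_le {γ q C₀ α₁ α₃ : ℝ} (β : ℝ) (hγu : γ ≤ 1) (hq1 : 1 ≤ q)
    (hq2 : q < minExp γ) (hC₀ : 0 < C₀) (hα₁ : 0 < α₁) (hα₃ : 0 < α₃) :
    ∃ C > (0 : ℝ), ∀ (a : E3) (τ : ℝ) (x : E3 → E3) (κ : E3 → ℝ),
      (∀ u, |‖a‖ - ‖x u‖| ≤ ‖u‖) → (∀ u, 0 ≤ κ u) →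
      (∀ u, u ≠ 0 → κ u ≤ C₀ * wGamma γ ‖u‖ * (1 + ‖a‖ + ‖x u‖) ^ (γ - 1) *
        rexp (-α₁ * ‖u‖ ^ 2) * rexp (-α₃ * (⟪u, a⟫ / ‖u‖ + τ * ‖u‖) ^ 2)) →
      ∫⁻ u, ENNReal.ofReal (κ u ^ q * (1 + ‖x u‖) ^ β) ≤
        ENNReal.ofReal (C * (1 + ‖a‖) ^ (β + q * (γ - 1) - 1)) := by
  obtain ⟨m, K, hK, hm, hw⟩ := exists_wGamma_le hq1 hq2
  have hq : 0 < q := by linarith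
  set D := (C₀ * K) ^ q * rexp ((2 * q + |β|) ^ 2 / (2 * (q * α₁)))
  have hD : 0 < D := by positivity
  set G : ℝ → ℝ≥0∞ := fun r => ENNReal.ofReal (r ^ (-(m * q)) * rexp (-(q * α₁ / 2) * r ^ 2))
    with hG
  set I := ∫⁻ r in Ioi (0 : ℝ), G r * ENNReal.ofReal (r ^ 2) with hI
  have hItop : I ≠ ⊤ := (lintegral_rpow_mul_exp_mul_sq_lt_top hm (by positivity)).ne
  have hs := Real.sqrt_nonneg (π / (q * α₃))
  refine ⟨D * (2 * π * (4 + 2 * √(π / (q * α₃)))) * (I.toReal + 1), by positivity,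
    fun a τ x κ hx hκ0 hκ => ?_⟩
  have hae : ∀ᵐ u : E3, u ≠ 0 := by simp [ae_iff]
  have hA : 0 < 1 + ‖a‖ := by positivity
  calc ∫⁻ u, ENNReal.ofReal (κ u ^ q * (1 + ‖x u‖) ^ β)
      ≤ ∫⁻ u, ENNReal.ofReal (D * (1 + ‖a‖) ^ (β + q * (γ - 1))) * (G ‖u‖ *
          ENNReal.ofReal (rexp (-(q * α₃) * (⟪u, a⟫ / ‖u‖ + τ * ‖u‖) ^ 2))) := by
        refine lintegral_mono_ae (hae.mono fun u hu => ?_)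
        have hu' := norm_pos_iff.2 hu
        rw [hG, ← ENNReal.ofReal_mul (by positivity), ← ENNReal.ofReal_mul (by positivity)]
        exact ENNReal.ofReal_le_ofReal (rpow_kernel_bound hγu hq1 hC₀ hα₁ hK (norm_nonneg a)
          (norm_nonneg _) hu' (hx u) (hw _ hu') (hκ0 u) (hκ u hu))
    _ ≤ ENNReal.ofReal (D * (1 + ‖a‖) ^ (β + q * (γ - 1))) *
          (ENNReal.ofReal (2 * π * ((4 + 2 * √(π / (q * α₃))) / (1 + ‖a‖))) * I) := by
        rw [lintegral_const_mul' _ _ ENNReal.ofReal_ne_top]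
        gcongr
        exact lintegral_radial_mul_gaussian_le (by positivity) τ (by fun_prop) a
    _ ≤ ENNReal.ofReal (D * (1 + ‖a‖) ^ (β + q * (γ - 1))) *
          (ENNReal.ofReal (2 * π * ((4 + 2 * √(π / (q * α₃))) / (1 + ‖a‖))) *
            ENNReal.ofReal (I.toReal + 1)) := by
        gcongr
        exact ENNReal.le_ofReal_iff_toReal_le hItop (by positivity) |>.2 (by linarith)
    _ = _ := by
        rw [← ENNReal.ofReal_mul (by positivity), ← ENNReal.ofReal_mul (by positivity),
          Real.rpow_sub_one hA.ne']
        congr 1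
        ring

/-- `q`-th power decay estimates for the conjugated kernel `k_α`:
`∫ |k_α(v,·)|^q (1+|·|)^β ≤ C (1+|v|)^{β+q(γ−1)−1}` and symmetrically. -/
theorem kalpha_q_decay_bounds (γ β q C₀ α₁ α₂ α₃ : ℝ) (hγl : -3 < γ) (hγu : γ ≤ 1)
    (hq1 : 1 ≤ q) (hq2 : q < minExp γ)
    (hC₀ : 0 < C₀) (hα₁ : 0 < α₁) (hα₂ : 0 < α₂) (hα₃ : 0 < α₃)
    (kα : E3 → E3 → ℝ) (hmeas : Measurable (Function.uncurry kα))
    (hb1 : ∀ v vs : E3, v ≠ vs →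
      |kα v vs| ≤ C₀ * wGamma γ ‖v - vs‖ * (1 + ‖v‖ + ‖vs‖) ^ (γ - 1) *
        Real.exp (-α₁ * ‖v - vs‖ ^ 2) *
        Real.exp (-α₃ * (⟪v - vs, v⟫ / ‖v - vs‖ - α₂ * ‖v - vs‖) ^ 2))
    (hb2 : ∀ v vs : E3, v ≠ vs →
      |kα v vs| ≤ C₀ * wGamma γ ‖v - vs‖ * (1 + ‖v‖ + ‖vs‖) ^ (γ - 1) *
        Real.exp (-α₁ * ‖v - vs‖ ^ 2) *
        Real.exp (-α₃ * (⟪v - vs, vs⟫ / ‖v - vs‖ + α₂ * ‖v - vs‖) ^ 2)) :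
    ∃ C > (0 : ℝ),
      (∀ v : E3,
        ∫⁻ vs : E3, ENNReal.ofReal (|kα v vs| ^ q * (1 + ‖vs‖) ^ β) ≤
          ENNReal.ofReal (C * (1 + ‖v‖) ^ (β + q * (γ - 1) - 1))) ∧
      (∀ vs : E3,
        ∫⁻ v : E3, ENNReal.ofReal (|kα v vs| ^ q * (1 + ‖v‖) ^ β) ≤
          ENNReal.ofReal (C * (1 + ‖vs‖) ^ (β + q * (γ - 1) - 1))) := by
  obtain ⟨C, hC, h⟩ := exists_lintegral_kernel_le β hγu hq1 hq2 hC₀ hα₁ hα₃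
  refine ⟨C, hC, fun v => ?_, fun vs => ?_⟩
  · rw [← lintegral_sub_left_eq_self _ v]
    refine h v (-α₂) (fun u => v - u) (fun u => |kα v (v - u)|) (fun u => ?_)
      (fun u => abs_nonneg _) fun u hu => ?_
    · simpa using abs_norm_sub_norm_le v (v - u)
    · have hne : v ≠ v - u := fun h => hu (sub_eq_self.1 h.symm)
      simpa [sub_eq_add_neg] using hb1 v (v - u) hne
  · rw [← lintegral_add_left_eq_self _ vs]
    refine h vs α₂ (fun u => vs + u) (fun u => |kα (vs + u) vs|) (fun u => ?_)
      (fun u => abs_nonneg _) fun u hu => ?_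
    · simpa using abs_norm_sub_norm_le vs (vs + u)
    · have hne : vs + u ≠ vs := fun h => hu (by simpa using h)
      simpa [add_right_comm] using hb2 (vs + u) vs hne
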